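/- Let p be a prime, G a finite p-group, and χ ∈ Irr(G). Let M/N be a chief factor of G, and assume that every irreducible constituent of the induced character (1_N)^M is an irreducible constituent of the restriction (χχ̄)_M. Then for each δ ∈ Irr(M) with N ≤ Ker(δ), there exists an irreducible constituent θ_δ of χχ̄ such that the restriction (θ_δ)_M = θ_δ(1)·δ. In particular, there are at least p−1 distinct irreducible constituents of χχ̄ lying above irreducible constituents of (1_N)^M − 1_M. -/

import Mathlib

open scoped Classical

/-- The inner product of two class functions on a finite group. -/
noncomputable def charInner (G : Type) [Group G] (φ ψ : G → ℂ) : ℂ :=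
  (Nat.card G : ℂ)⁻¹ * ∑ᶠ g : G, φ g * (starRingEnd ℂ) (ψ g)

/-- `χ` is an irreducible complex character of `G`. -/
def IsIrrChar (G : Type) [Group G] (χ : G → ℂ) : Prop :=
  ∃ V : FDRep ℂ G, CategoryTheory.Simple V ∧ V.character = χ

/-- The complex conjugate of a character. -/
def conjChar {G : Type} (χ : G → ℂ) : G → ℂ := fun g => (starRingEnd ℂ) (χ g)

/-- The set of irreducible constituents of a character `Θ` of `G`. -/
def constituents (G : Type) [Group G] (Θ : G → ℂ) : Set (G → ℂ) :=
  {θ | IsIrrChar G θ ∧ charInner G θ Θ ≠ 0}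

/-- `η χ ψ` : the number of distinct irreducible constituents of the product `χ ψ`. -/
noncomputable def eta (G : Type) [Group G] (χ ψ : G → ℂ) : ℕ :=
  (constituents G (χ * ψ)).ncard

/-- The character of `G` induced from the character `γ` of a subgroup `H`. -/
noncomputable def indChar {G : Type} [Group G] (H : Subgroup G) (γ : ↥H → ℂ) : G → ℂ :=
  fun g => (Nat.card ↥H : ℂ)⁻¹ *
    ∑ᶠ x : G, if h : x * g * x⁻¹ ∈ H then γ ⟨x * g * x⁻¹, h⟩ else 0

/-- Restriction of a character of `G` to a subgroup `M`. -/
def resChar {G : Type} [Group G] (M : Subgroup G) (χ : G → ℂ) : ↥M → ℂ := fun m => χ (m : G)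

/-- Restriction of a character of a subgroup `M` to a smaller subgroup `N ≤ M`. -/
def resChar₂ {G : Type} [Group G] {N M : Subgroup G} (h : N ≤ M) (μ : ↥M → ℂ) : ↥N → ℂ :=
  fun n => μ ⟨n.1, h n.2⟩

/-- The character of `M` induced from the character `ν` of `N`, where `N ≤ M` are
subgroups of `G`. -/
noncomputable def indCharSub {G : Type} [Group G] (N M : Subgroup G) (ν : ↥N → ℂ) : ↥M → ℂ :=
  indChar (N.subgroupOf M) (fun x => ν ⟨x.1.1, x.2⟩)

/-- The inertia group (stabilizer) `G_ν` of a character `ν` of a normal subgroup `N` of `G`. -/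
def inertia {G : Type} [Group G] (N : Subgroup G) (hN : N.Normal) (ν : ↥N → ℂ) : Subgroup G where
  carrier := {g : G | ∀ n : ↥N, ν (@MulAut.conjNormal G _ N hN g n) = ν n}
  one_mem' := by intro n; simp
  mul_mem' := by
    intro a b ha hb n
    rw [map_mul]
    exact (ha _).trans (hb n)
  inv_mem' := by
    intro a ha n
    have h := ha ((@MulAut.conjNormal G _ N hN a)⁻¹ n)
    rw [MulAut.apply_inv_self] at h
    rw [map_inv]
    exact h.symm

/-- `M/N` is a chief factor of `G`. -/
structure IsChiefFactor {G : Type} [Group G] (N M : Subgroup G) : Prop where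
  normalN : N.Normal
  normalM : M.Normal
  lt : N < M
  max : ∀ K : Subgroup G, K.Normal → N ≤ K → K ≤ M → K = N ∨ K = M


open Module Representation

section Representations

variable {G V : Type} [Group G] [Finite G] [AddCommGroup V] [Module ℂ V]
  [FiniteDimensional ℂ V]

/-- Character values at inverse elements are complex conjugates. -/
theorem character_inv_eq_conj (ρ : Representation ℂ G V) (x : G) :
    ρ.character x⁻¹ = (starRingEnd ℂ) (ρ.character x) := by
  classical
  cases nonempty_fintype G
  let b := Module.finBasis ℂ V
  let A : G → Matrix (Fin (finrank ℂ V)) (Fin (finrank ℂ V)) ℂ :=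
    fun g => LinearMap.toMatrix b b (ρ g)
  have hA1 : A 1 = 1 := by simp [A]
  have hAmul : ∀ g h, A (g * h) = A g * A h := fun g h => by
    simp only [A, map_mul]
    exact LinearMap.toMatrix_mul b (ρ g) (ρ h)
  have htr : ∀ g, ρ.character g = (A g).trace := fun g =>
    LinearMap.trace_eq_matrix_trace ℂ b (ρ g)
  open scoped MatrixOrder ComplexOrder in
  have hpos : (∑ g, (A g).conjTranspose * A g).PosDef := by
    rw [← Finset.add_sum_erase _ _ (Finset.mem_univ (1 : G))]
    refine Matrix.PosDef.add_posSemidef ?_ (Matrix.posSemidef_sum _ fun g _ =>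
      Matrix.posSemidef_conjTranspose_mul_self _)
    rw [hA1]
    simpa using Matrix.PosDef.one
  set H := ∑ g, (A g).conjTranspose * A g with hH
  have hunit : IsUnit H.det := (Matrix.isUnit_iff_isUnit_det H).mp hpos.isUnit
  have hinv : (A x).conjTranspose * H * A x = H := by
    rw [hH, Finset.mul_sum, Finset.sum_mul]
    refine Fintype.sum_equiv (Equiv.mulRight x) _ _ fun g => ?_
    simp [hAmul, Matrix.conjTranspose_mul, Matrix.mul_assoc]
  have hx : A x * A x⁻¹ = 1 := by rw [← hAmul, mul_inv_cancel, hA1]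
  have hconj : (A x).conjTranspose * H = H * A x⁻¹ := by
    conv_rhs => rw [← hinv, Matrix.mul_assoc, hx, Matrix.mul_one]
  have hfin : A x⁻¹ = H⁻¹ * ((A x).conjTranspose * H) := by
    rw [hconj, ← Matrix.mul_assoc, Matrix.nonsing_inv_mul _ hunit, Matrix.one_mul]
  rw [htr, htr, hfin, Matrix.trace_mul_comm, Matrix.mul_assoc, Matrix.mul_nonsing_inv _ hunit,
    Matrix.mul_one, Matrix.trace_conjTranspose]
  rfl

/-- A nonzero finite-dimensional representation contains an irreducible one. -/
theorem exists_irreducible_injective_intertwiningMap {G : Type} [Group G] (n : ℕ) :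
    ∀ (V : Type) [AddCommGroup V] [Module ℂ V] [FiniteDimensional ℂ V] [Nontrivial V]
      (ρ : Representation ℂ G V), finrank ℂ V = n →
      ∃ (U : Type) (_ : AddCommGroup U) (_ : Module ℂ U) (_ : FiniteDimensional ℂ U)
        (σ : Representation ℂ G U) (f : IntertwiningMap σ ρ),
        IsIrreducible σ ∧ Function.Injective f := by
  induction n using Nat.strong_induction_on with
  | _ n ih =>
    intro V _ _ _ _ ρ hn
    by_cases hirr : IsIrreducible ρ
    · exact ⟨V, inferInstance, inferInstance, inferInstance, ρ, IntertwiningMap.id ρ, hirr,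
        fun _ _ h => h⟩
    · have hsub : ∃ W : Subrepresentation ρ, W.toSubmodule ≠ ⊥ ∧ W.toSubmodule ≠ ⊤ := by
        by_contra! hcon
        have : Nontrivial (Subrepresentation ρ) := ⟨⊥, ⊤, fun h =>
          bot_ne_top (α := Submodule ℂ V) (congrArg Subrepresentation.toSubmodule h)⟩
        refine hirr ⟨?_⟩
        · intro W
          by_cases hW : W.toSubmodule = ⊥
          · exact Or.inl (Subrepresentation.toSubmodule_injective hW)
          · exact Or.inr (Subrepresentation.toSubmodule_injective (hcon W hW))
      obtain ⟨W, hW0, hW1⟩ := hsub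
      have : Nontrivial W.toSubmodule := Submodule.nontrivial_iff_ne_bot.mpr hW0
      obtain ⟨U, _, _, _, σ, f, hσ, hf⟩ := ih _ (hn ▸ Submodule.finrank_lt hW1)
        W.toSubmodule W.toRepresentation rfl
      let i : IntertwiningMap W.toRepresentation ρ :=
        ⟨W.toSubmodule.subtype, fun g => by ext v; rfl⟩
      exact ⟨U, _, _, ‹_›, σ, i.comp f, hσ, Subtype.val_injective.comp hf⟩

/-- The inner product of two characters, computed by intertwining maps. -/
theorem charInner_character {U : Type} [AddCommGroup U] [Module ℂ U] [FiniteDimensional ℂ U]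
    (σ : Representation ℂ G U) (ρ : Representation ℂ G V) :
    charInner G σ.character ρ.character = finrank ℂ (IntertwiningMap ρ σ) := by
  cases nonempty_fintype G
  have : Invertible (Nat.card G : ℂ) := invertibleOfNonzero (NeZero.ne _)
  rw [← card_inv_mul_sum_char_mul_char_eq_finrank, charInner, finsum_eq_sum_of_fintype]
  simp_rw [character_inv_eq_conj]

theorem charInner_conj_symm {G : Type} [Group G] [Finite G] (φ ψ : G → ℂ) :
    (starRingEnd ℂ) (charInner G φ ψ) = charInner G ψ φ := by
  cases nonempty_fintype G
  simp [charInner, finsum_eq_sum_of_fintype, map_sum, mul_comm]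

/-- A representation whose character has norm one affords an irreducible character. -/
theorem isIrrChar_of_charInner_self (ρ : Representation ℂ G V)
    (h : charInner G ρ.character ρ.character = 1) : IsIrrChar G ρ.character := by
  cases nonempty_fintype G
  refine ⟨FDRep.of ρ, ?_, rfl⟩
  rw [FDRep.simple_iff_char_is_norm_one]
  rw [charInner, finsum_eq_sum_of_fintype, inv_mul_eq_one₀ (NeZero.ne _)] at h
  rw [h]
  refine Finset.sum_congr rfl fun g _ => ?_
  rw [← character_inv_eq_conj]
  rfl

/-- Every irreducible character is afforded by a representation and has norm one. -/
theorem IsIrrChar.exists_representation {χ : G → ℂ} (hχ : IsIrrChar G χ) :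
    ∃ (V : Type) (_ : AddCommGroup V) (_ : Module ℂ V) (_ : FiniteDimensional ℂ V)
      (ρ : Representation ℂ G V), ρ.character = χ ∧ charInner G χ χ = 1 := by
  cases nonempty_fintype G
  obtain ⟨V, hV, rfl⟩ := hχ
  refine ⟨V, inferInstance, inferInstance, inferInstance, V.ρ, rfl, ?_⟩
  rw [FDRep.simple_iff_char_is_norm_one] at hV
  rw [charInner, finsum_eq_sum_of_fintype, inv_mul_eq_one₀ (NeZero.ne _), ← hV]
  refine Finset.sum_congr rfl fun g _ => ?_
  congr 1
  exact character_inv_eq_conj V.ρ g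

theorem charInner_eq_zero_of_ne {χ ψ : G → ℂ} (hχ : IsIrrChar G χ) (hψ : IsIrrChar G ψ)
    (hne : χ ≠ ψ) : charInner G χ ψ = 0 := by
  cases nonempty_fintype G
  obtain ⟨V, hV, rfl⟩ := hχ
  obtain ⟨W, hW, rfl⟩ := hψ
  have : Invertible (Nat.card G : ℂ) := invertibleOfNonzero (NeZero.ne _)
  have h := FDRep.char_orthonormal V W
  rw [if_neg fun ⟨i⟩ => hne (FDRep.char_iso i)] at h
  rw [charInner, finsum_eq_sum_of_fintype, ← h]
  congr 1
  refine Finset.sum_congr rfl fun g _ => ?_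
  congr 1
  exact (character_inv_eq_conj W.ρ g).symm

/-- A finite group has finitely many irreducible characters. -/
theorem finite_setOf_isIrrChar (G : Type) [Group G] [Finite G] : {χ | IsIrrChar G χ}.Finite := by
  cases nonempty_fintype G
  have hli : LinearIndependent ℂ (fun χ : {χ | IsIrrChar G χ} => (χ : G → ℂ)) := by
    rw [linearIndependent_iff']
    intro s c hc χ hχ
    have hinner : ∑ ψ ∈ s, c ψ * charInner G ψ χ = 0 := by
      have : charInner G (∑ ψ ∈ s, c ψ • (ψ : G → ℂ)) χ = 0 := by
        rw [hc]
        simp [charInner]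
      rw [← this]
      simp only [charInner, finsum_eq_sum_of_fintype, Finset.sum_apply, Pi.smul_apply,
        smul_eq_mul, Finset.mul_sum, Finset.sum_mul]
      rw [Finset.sum_comm]
      refine Finset.sum_congr rfl fun g _ => Finset.sum_congr rfl fun ψ _ => by ring
    rw [Finset.sum_eq_single χ] at hinner
    · obtain ⟨_, _, _, _, _, _, h1⟩ := IsIrrChar.exists_representation χ.2
      simpa [h1] using hinner
    · intro ψ _ hne
      rw [charInner_eq_zero_of_ne ψ.2 χ.2 (fun h => hne (Subtype.ext h)), mul_zero]
    · exact fun h => absurd hχ h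
  have : Finite {χ | IsIrrChar G χ} := hli.finite
  exact Set.toFinite _

/-- An irreducible character whose kernel contains all commutators is linear. -/
theorem IsIrrChar.linear_of_commutator_mem {δ : G → ℂ} (hδ : IsIrrChar G δ) (K : Subgroup G)
    (hK : ∀ a b : G, a * b * a⁻¹ * b⁻¹ ∈ K) (hδK : ∀ x ∈ K, δ x = δ 1) :
    δ 1 = 1 ∧ ∀ a b, δ (a * b) = δ a * δ b := by
  cases nonempty_fintype G
  obtain ⟨V, _, _, _, ρ, rfl, hnorm⟩ := hδ.exists_representation
  have htriv : ∀ x ∈ K, ρ x = 1 := by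
    have : Invertible (Nat.card K : ℂ) := invertibleOfNonzero (NeZero.ne _)
    have h := card_inv_mul_sum_char_eq_finrank (ρ.comp K.subtype)
    have hchar : ∀ k : K, (character (ρ.comp K.subtype) k : ℂ) = finrank ℂ V := fun k => by
      rw [← char_one ρ, ← hδK k k.2]
      rfl
    simp only [hchar, Finset.sum_const, Finset.card_univ, nsmul_eq_mul, Fintype.card_eq_nat_card]
      at h
    rw [inv_mul_cancel_left₀ (NeZero.ne _), Nat.cast_inj] at h
    have htop := Submodule.eq_top_of_finrank_eq h.symm
    intro x hx
    ext v
    have hv : v ∈ invariants (ρ.comp K.subtype) := htop ▸ Submodule.mem_top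
    exact hv ⟨x, hx⟩
  have hcomm : ∀ a b, ρ a * ρ b = ρ b * ρ a := fun a b => by
    have : a * b = (a * b * a⁻¹ * b⁻¹) * (b * a) := by group
    rw [← map_mul, this, map_mul, htriv _ (hK a b), one_mul, map_mul]
  have hend : finrank ℂ (IntertwiningMap ρ ρ) = 1 := by
    rw [charInner_character] at hnorm
    exact_mod_cast hnorm
  have hid : IntertwiningMap.id ρ ≠ 0 := by
    intro h0
    have : Subsingleton (IntertwiningMap ρ ρ) := ⟨fun f g => by
      have hz : ∀ f : IntertwiningMap ρ ρ, f = 0 := fun f => by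
        ext v
        have hv : v = 0 := DFunLike.congr_fun h0 v
        simp [hv]
      rw [hz f, hz g]⟩
    rw [finrank_zero_of_subsingleton] at hend
    exact zero_ne_one hend
  have hscal : ∀ a, ∃ c : ℂ, ρ a = c • 1 := fun a => by
    obtain ⟨c, hc⟩ := (finrank_eq_one_iff_of_nonzero' _ hid).mp hend
      ⟨ρ a, fun b => hcomm a b⟩
    refine ⟨c, ?_⟩
    ext v
    exact (DFunLike.congr_fun hc v).symm
  choose c hc using hscal
  have hchar : ∀ a, ρ.character a = c a * finrank ℂ V := fun a => by
    simp [character, hc]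
  have hV : Nontrivial V := by
    by_contra hV
    rw [not_nontrivial_iff_subsingleton] at hV
    apply hid
    ext v
    exact Subsingleton.elim _ _
  have hcmul : ∀ a b, c (a * b) = c a * c b := fun a b => by
    obtain ⟨v, hv⟩ := exists_ne (0 : V)
    have h := LinearMap.congr_fun (map_mul ρ a b) v
    simp only [hc, LinearMap.smul_apply, Module.End.one_apply, Module.End.mul_apply, smul_smul]
      at h
    exact smul_left_injective ℂ hv h
  have hc1 : c 1 = 1 := by
    obtain ⟨v, hv⟩ := exists_ne (0 : V)
    have h := LinearMap.congr_fun (map_one ρ) v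
    simp only [hc, LinearMap.smul_apply, Module.End.one_apply] at h
    exact smul_left_injective ℂ hv (h.trans (one_smul ℂ v).symm)
  have hdim : finrank ℂ V = 1 := by
    have hterm : ∀ a, ρ.character a * (starRingEnd ℂ) (ρ.character a) = (finrank ℂ V : ℂ) ^ 2 :=
      fun a => by
        rw [← character_inv_eq_conj, hchar, hchar]
        calc _ = c (a * a⁻¹) * (finrank ℂ V : ℂ) ^ 2 := by rw [hcmul]; ring
          _ = _ := by rw [mul_inv_cancel, hc1, one_mul]
    simp only [charInner, finsum_eq_sum_of_fintype, hterm, Finset.sum_const, Finset.card_univ,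
      nsmul_eq_mul, Fintype.card_eq_nat_card] at hnorm
    rw [inv_mul_cancel_left₀ (NeZero.ne _)] at hnorm
    have : finrank ℂ V ^ 2 = 1 := by exact_mod_cast hnorm
    simpa using this
  simp only [hchar, hdim, Nat.cast_one, mul_one]
  exact ⟨hc1, hcmul⟩

/-- Irreducible characters do not vanish at the identity. -/
theorem IsIrrChar.apply_one_ne_zero {χ : G → ℂ} (hχ : IsIrrChar G χ) : χ 1 ≠ 0 := by
  obtain ⟨V, _, _, _, ρ, rfl, hnorm⟩ := hχ.exists_representation
  rw [char_one, Nat.cast_ne_zero]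
  intro h0
  have : Subsingleton V := finrank_zero_iff.mp h0
  have : Subsingleton (IntertwiningMap ρ ρ) :=
    ⟨fun _ _ => DFunLike.ext _ _ fun _ => Subsingleton.elim _ _⟩
  rw [charInner_character, finrank_zero_of_subsingleton, Nat.cast_zero] at hnorm
  exact zero_ne_one hnorm

/-- An invariant linear character `δ` of a subgroup `M` lying under the character of `ρ` lies under
some irreducible constituent whose restriction to `M` is a multiple of `δ`. -/
theorem exists_constituent_resChar_eq (ρ : Representation ℂ G V) (M : Subgroup G) [M.Normal]
    {δ : M → ℂ} (hδ1 : δ 1 = 1) (hmul : ∀ a b, δ (a * b) = δ a * δ b)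
    (hconj : ∀ (g : G) (m m' : M), (m' : G) = g * m * g⁻¹ → δ m' = δ m)
    (hne : charInner M δ (resChar M ρ.character) ≠ 0) :
    ∃ θ ∈ constituents G ρ.character, resChar M θ = fun m => θ 1 * δ m := by
  cases nonempty_fintype G
  cases nonempty_fintype M
  let P : V →ₗ[ℂ] V := ∑ m : M, δ m⁻¹ • ρ m
  have htr : LinearMap.trace ℂ V P ≠ 0 := by
    intro h0
    apply hne
    have : LinearMap.trace ℂ V P = ∑ m : M, δ m * (starRingEnd ℂ) (resChar M ρ.character m) := by
      simp only [P, map_sum, map_smul, smul_eq_mul]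
      refine Fintype.sum_equiv (Equiv.inv M) _ _ fun m => ?_
      simp only [Equiv.inv_apply, resChar]
      rw [← character_inv_eq_conj]
      simp [character]
    rw [charInner, finsum_eq_sum_of_fintype, ← this, h0, mul_zero]
  have hP : P ≠ 0 := fun h => htr (by rw [h, map_zero])
  have hPeig : ∀ (n : M) (v : V), ρ n (P v) = δ n • P v := fun n v => by
    simp only [P, LinearMap.sum_apply, map_sum, LinearMap.smul_apply, map_smul, Finset.smul_sum]
    refine Fintype.sum_equiv (Equiv.mulLeft n) _ _ fun m => ?_
    have hδ : δ n * δ (n * m)⁻¹ = δ m⁻¹ := by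
      rw [mul_inv_rev, hmul, mul_left_comm, ← hmul, mul_inv_cancel, hδ1, mul_one]
    rw [Equiv.coe_mulLeft, smul_smul, hδ, Subgroup.coe_mul, map_mul, Module.End.mul_apply]
  let W : Subrepresentation ρ :=
    { toSubmodule :=
        { carrier := {v | ∀ m : M, ρ m v = δ m • v}
          zero_mem' := by simp
          add_mem' := by
            intro a b ha hb m
            rw [map_add, ha, hb, smul_add]
          smul_mem' := by
            intro r a ha m
            rw [map_smul, ha, smul_comm] }
      apply_mem_toSubmodule := by
        intro g v hv m
        let m' : M := ⟨g⁻¹ * m * g, Subgroup.Normal.conj_mem' inferInstance _ m.2 g⟩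
        have hm : (m : G) = g * m' * g⁻¹ := by simp [m', mul_assoc]
        have hmul' : (m : G) * g = g * m' := by rw [hm]; group
        rw [← Module.End.mul_apply, ← map_mul, hmul', map_mul, Module.End.mul_apply, hv m',
          map_smul, hconj g m' m hm] }
  have hW : Nontrivial W.toSubmodule := by
    obtain ⟨v, hv⟩ := DFunLike.ne_iff.mp hP
    exact ⟨⟨⟨P v, fun m => hPeig m v⟩, 0, fun h => hv (congrArg Subtype.val h)⟩⟩
  obtain ⟨U, _, _, _, σ, f, hσ, hf⟩ := exists_irreducible_injective_intertwiningMap _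
    W.toSubmodule W.toRepresentation rfl
  have hσm : ∀ m : M, σ m = δ m • 1 := fun m => by
    ext u
    apply hf
    rw [IntertwiningMap.isIntertwining]
    apply Subtype.ext
    refine Eq.trans ((f u).2 m) ?_
    simp
  have hirr : IsIrrChar G σ.character := by
    apply isIrrChar_of_charInner_self
    rw [charInner_character, IsIrreducible.finrank_intertwiningMap_self, Nat.cast_one]
  have hσU : Nontrivial U := by
    have h := hirr.apply_one_ne_zero
    rw [char_one, Nat.cast_ne_zero] at h
    exact nontrivial_of_finrank_pos (Nat.pos_of_ne_zero h)
  refine ⟨σ.character, ⟨hirr, ?_⟩, ?_⟩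
  · rw [← charInner_conj_symm, map_ne_zero, charInner_character, Nat.cast_ne_zero]
    let i : IntertwiningMap W.toRepresentation ρ :=
      ⟨W.toSubmodule.subtype, fun g => by ext v; rfl⟩
    have : Module.Finite ℂ (IntertwiningMap σ ρ) :=
      (invariantsEquivIntertwiningMap σ ρ).finiteDimensional
    refine (finrank_pos_iff_exists_ne_zero.mpr ⟨i.comp f, fun h0 => ?_⟩).ne'
    obtain ⟨u, hu⟩ := exists_ne (0 : U)
    have h : i.comp f u = 0 := by rw [h0]; rfl
    exact hu (hf ((Subtype.val_injective h).trans (map_zero f).symm))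
  · funext m
    rw [char_one, mul_comm]
    simp [resChar, character, hσm]

/-- A homomorphism to `ℂˣ` is an irreducible character. -/
theorem isIrrChar_of_monoidHom (φ : G →* ℂˣ) : IsIrrChar G (fun g => (φ g : ℂ)) := by
  cases nonempty_fintype G
  let ρ : Representation ℂ G ℂ :=
    { toFun := fun g => (φ g : ℂ) • LinearMap.id
      map_one' := by ext; simp
      map_mul' := fun a b => by ext; simp [mul_comm] }
  have hchar : ρ.character = fun g => (φ g : ℂ) := by
    funext g
    simp [character, ρ]
  rw [← hchar]
  apply isIrrChar_of_charInner_self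
  have hterm : ∀ g, ρ.character g * (starRingEnd ℂ) (ρ.character g) = 1 := fun g => by
    rw [← character_inv_eq_conj, hchar, ← Units.val_mul, ← map_mul, mul_inv_cancel, map_one,
      Units.val_one]
  simp only [charInner, finsum_eq_sum_of_fintype, hterm, Finset.sum_const, Finset.card_univ,
    nsmul_eq_mul, Fintype.card_eq_nat_card, mul_one]
  exact inv_mul_cancel₀ (NeZero.ne _)

end Representations

/-- Chief factors of finite `p`-groups are central. -/
theorem IsChiefFactor.commutator_mem {p : ℕ} (hp : p.Prime) {G : Type} [Group G] [Finite G]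
    (hG : IsPGroup p G) {N M : Subgroup G} (hcf : IsChiefFactor N M) (g : G) {m : G} (hm : m ∈ M) :
    g * m * g⁻¹ * m⁻¹ ∈ N := by
  have := Fact.mk hp
  have := hcf.normalN
  have := hcf.normalM
  let π := QuotientGroup.mk' N
  let Mbar := M.map π
  have : Mbar.Normal := Subgroup.Normal.map ‹_› π (QuotientGroup.mk'_surjective N)
  let K : Subgroup G := (Subgroup.center (G ⧸ N)).comap π ⊓ M
  have hK : K = N ∨ K = M := by
    refine hcf.max K inferInstance (le_inf (fun n hn => ?_) hcf.lt.le) inf_le_right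
    have h1 : π n = 1 := (QuotientGroup.eq_one_iff n).mpr hn
    rw [Subgroup.mem_comap, h1]
    exact one_mem _
  rcases hK with hK | hK
  · exfalso
    -- the conjugation action of `G ⧸ N` on `M ⧸ N` has a nontrivial fixed point
    have hcard : p ∣ Nat.card Mbar := by
      refine ((hG.to_quotient N).to_subgroup Mbar).card_eq_or_dvd.resolve_left fun h1 => ?_
      have hbot : Mbar = ⊥ := Subgroup.card_eq_one.mp h1
      have hle : M ≤ N := fun m hm => by
        have : π m ∈ Mbar := Subgroup.mem_map_of_mem π hm
        rw [hbot, Subgroup.mem_bot] at this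
        exact (QuotientGroup.eq_one_iff m).mp this
      exact hcf.lt.not_ge hle
    let act : MulAction (G ⧸ N) Mbar :=
      MulAction.compHom Mbar (MulAut.conjNormal (H := Mbar))
    have hsmul : ∀ (x : G ⧸ N) (y : Mbar), ((x • y : Mbar) : G ⧸ N) = x * y * x⁻¹ := fun x y =>
      MulAut.conjNormal_apply x y
    obtain ⟨b, hb, hne⟩ := (hG.to_quotient N).exists_fixed_point_of_prime_dvd_card_of_fixed_point
      Mbar hcard (a := 1) (fun x => Subtype.ext (by rw [hsmul]; simp))
    obtain ⟨m, hm, hmb⟩ := b.2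
    have hmK : m ∈ K := by
      refine ⟨Subgroup.mem_center_iff.mpr fun x => ?_, hm⟩
      have := congrArg Subtype.val (hb x)
      rw [hsmul] at this
      rw [hmb]
      exact mul_inv_eq_iff_eq_mul.mp this
    rw [hK] at hmK
    exact hne (Subtype.ext (((QuotientGroup.eq_one_iff m).mpr hmK).symm.trans hmb))
  · have hmK : m ∈ K := hK ▸ hm
    have hc := Subgroup.mem_center_iff.mp hmK.1 (π g)
    rw [← QuotientGroup.eq_one_iff]
    change π (g * m * g⁻¹ * m⁻¹) = 1
    rw [map_mul, map_mul, map_mul, hc, map_inv, map_inv]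
    group

/-- The character of `M` induced from the principal character of a normal subgroup `N`. -/
theorem indCharSub_one {G : Type} [Group G] [Finite G] {N M : Subgroup G} (hN : N.Normal)
    (m : M) : indCharSub N M 1 m =
      if (m : G) ∈ N then (Nat.card (N.subgroupOf M) : ℂ)⁻¹ * Nat.card M else 0 := by
  cases nonempty_fintype M
  have hmem : ∀ x : M, x * m * x⁻¹ ∈ N.subgroupOf M ↔ (m : G) ∈ N := fun x =>
    ⟨fun h => by simpa [mul_assoc] using hN.conj_mem _ (Subgroup.mem_subgroupOf.mp h) (x : G)⁻¹,
      fun h => hN.conj_mem _ h _⟩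
  simp only [indCharSub, indChar, hmem, finsum_eq_sum_of_fintype]
  split_ifs <;> simp

/-- Every character of `M` with `N` in its kernel lies under the character induced from `1_N`. -/
theorem charInner_indCharSub_one_ne_zero {G : Type} [Group G] [Finite G] {N M : Subgroup G}
    (hN : N.Normal) {δ : M → ℂ} (hδ1 : δ 1 ≠ 0)
    (hδ : ∀ x : M, (x : G) ∈ N → δ x = δ 1) : charInner M δ (indCharSub N M 1) ≠ 0 := by
  cases nonempty_fintype M
  have hterm : ∀ m : M, δ m * (starRingEnd ℂ) (indCharSub N M 1 m) =
      if (m : G) ∈ N then δ 1 * ((Nat.card (N.subgroupOf M) : ℂ)⁻¹ * Nat.card M) else 0 :=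
    fun m => by
      rw [indCharSub_one hN]
      split_ifs with h
      · simp [hδ m h]
      · simp
  simp only [charInner, finsum_eq_sum_of_fintype, hterm]
  rw [← Finset.sum_filter, Finset.sum_const, nsmul_eq_mul]
  have hpos : (Finset.univ.filter fun m : M => (m : G) ∈ N).card ≠ 0 :=
    Finset.card_ne_zero_of_mem (a := 1) (by simp [one_mem])
  have h1 : (Nat.card (N.subgroupOf M) : ℂ) ≠ 0 := NeZero.ne _
  have h2 : (Nat.card M : ℂ) ≠ 0 := NeZero.ne _
  have h3 : ((Finset.univ.filter fun m : M => (m : G) ∈ N).card : ℂ) ≠ 0 := by exact_mod_cast hpos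
  exact mul_ne_zero (inv_ne_zero h2)
    (mul_ne_zero h3 (mul_ne_zero hδ1 (mul_ne_zero (inv_ne_zero h1) h2)))

/-- **Lemma.** Let `G` be a finite `p`-group, `χ ∈ Irr(G)`, and `M/N` a chief factor of `G`.
Assume `Ξ((1_N)^M) ⊆ Ξ((χχ̄)_M)`. Then for each `δ ∈ Irr(M mod N)` there is
`θ_δ ∈ Ξ(χχ̄)` with `(θ_δ)_M = θ_δ(1) δ`. In particular there are at least `p - 1`
distinct members of `Ξ(χχ̄)` lying above irreducible constituents of `(1_N)^M - 1_M`. -/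
theorem constituents_above_chief_factor {p : ℕ} (hp : p.Prime)
    (G : Type) [Group G] [Finite G] (hG : IsPGroup p G)
    (χ : G → ℂ) (hχ : IsIrrChar G χ)
    (N M : Subgroup G) (hcf : IsChiefFactor N M)
    (hsub : constituents ↥M (indCharSub N M 1) ⊆
      constituents ↥M (resChar M (χ * conjChar χ))) :
    (∀ δ : ↥M → ℂ, IsIrrChar ↥M δ → (∀ x : ↥M, (x : G) ∈ N → δ x = δ 1) →
      ∃ θ ∈ constituents G (χ * conjChar χ),
        resChar M θ = fun m => θ 1 * δ m) ∧
    p - 1 ≤ Set.ncard {θ : G → ℂ | θ ∈ constituents G (χ * conjChar χ) ∧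
      ∃ δ ∈ constituents ↥M (indCharSub N M 1), δ ≠ 1 ∧
        charInner ↥M δ (resChar M θ) ≠ 0} := by
  have := hcf.normalN
  have := hcf.normalM
  have := Fact.mk hp
  have hcomm : ∀ a b : M, a * b * a⁻¹ * b⁻¹ ∈ N.subgroupOf M := fun a b =>
    hcf.commutator_mem hp hG (a : G) b.2
  have hlift : ∀ δ : M → ℂ, IsIrrChar M δ → (∀ x : M, (x : G) ∈ N → δ x = δ 1) →
      δ ∈ constituents M (indCharSub N M 1) := fun δ hδ hδN =>
    ⟨hδ, charInner_indCharSub_one_ne_zero hcf.normalN hδ.apply_one_ne_zero hδN⟩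
  have hmain : ∀ δ : M → ℂ, IsIrrChar M δ → (∀ x : M, (x : G) ∈ N → δ x = δ 1) →
      ∃ θ ∈ constituents G (χ * conjChar χ), resChar M θ = fun m => θ 1 * δ m := by
    intro δ hδ hδN
    have hconst := hsub (hlift δ hδ hδN)
    obtain ⟨hδ1, hmul⟩ := hδ.linear_of_commutator_mem (N.subgroupOf M) hcomm hδN
    obtain ⟨V, _, _, _, ρ, rfl, -⟩ := hχ.exists_representation
    have hprod : ρ.character * conjChar ρ.character = (linHom ρ ρ).character := by
      funext g
      rw [char_linHom, character_inv_eq_conj, mul_comm]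
      rfl
    rw [hprod] at hconst ⊢
    refine exists_constituent_resChar_eq (linHom ρ ρ) M hδ1 hmul (fun g m m' hm => ?_) hconst.2
    have hn : g * m * g⁻¹ * (m : G)⁻¹ ∈ N := hcf.commutator_mem hp hG g m.2
    have hm' : m' = m' * m⁻¹ * m := by group
    rw [hm', hmul, hδN _ (by simpa [hm] using hn), hδ1, one_mul]
  refine ⟨hmain, ?_⟩
  let Q := M ⧸ N.subgroupOf M
  let instQ : CommGroup Q :=
    { (inferInstance : Group Q) with
      mul_comm := by
        rintro ⟨a⟩ ⟨b⟩
        refine QuotientGroup.eq.mpr ?_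
        have := hcomm b⁻¹ a⁻¹
        simpa [mul_assoc] using this }
  have hQcard : p ≤ Nat.card Q := by
    refine Nat.le_of_dvd Nat.card_pos
      (((hG.to_subgroup M).to_quotient (N.subgroupOf M)).card_eq_or_dvd.resolve_left fun h1 => ?_)
    have : (N.subgroupOf M).index = 1 := h1
    rw [Subgroup.index_eq_one, Subgroup.subgroupOf_eq_top] at this
    exact hcf.lt.not_ge this
  have hdual : Nat.card (Q →* ℂˣ) = Nat.card Q :=
    CommGroup.card_monoidHom_of_hasEnoughRootsOfUnity Q ℂ
  have : Finite (Q →* ℂˣ) := Nat.finite_of_card_ne_zero (hdual ▸ Nat.card_pos.ne')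
  let lin : (Q →* ℂˣ) → M → ℂ := fun φ m => (φ (QuotientGroup.mk m) : ℂ)
  have hlin_inj : Function.Injective lin := fun φ ψ h => by
    ext m
    exact congrFun h m
  have hlin_irr : ∀ φ, IsIrrChar M (lin φ) := fun φ =>
    isIrrChar_of_monoidHom (φ.comp (QuotientGroup.mk' (N.subgroupOf M)))
  have hlin_ker : ∀ φ (x : M), (x : G) ∈ N → lin φ x = lin φ 1 := fun φ x hx => by
    have : (QuotientGroup.mk x : Q) = QuotientGroup.mk 1 :=
      (QuotientGroup.eq_one_iff x).mpr hx
    simp only [lin, this]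
  choose θ hθ hres using fun φ => hmain (lin φ) (hlin_irr φ) (hlin_ker φ)
  have hθ_inj : Function.Injective θ := fun φ ψ h => hlin_inj <| by
    funext m
    have := (congrFun (hres φ) m).symm.trans ((congrArg (resChar M · m) h).trans
      (congrFun (hres ψ) m))
    rw [h] at this
    exact mul_left_cancel₀ (hθ ψ).1.apply_one_ne_zero this
  have hcount : ({1}ᶜ : Set (Q →* ℂˣ)).ncard = Nat.card Q - 1 := by
    rw [Set.ncard_compl, Set.ncard_singleton, hdual]
  calc p - 1 ≤ ({1}ᶜ : Set (Q →* ℂˣ)).ncard := by rw [hcount]; exact Nat.sub_le_sub_right hQcard 1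
    _ = (θ '' {1}ᶜ).ncard := (Set.ncard_image_of_injective _ hθ_inj).symm
    _ ≤ _ := by
      refine Set.ncard_le_ncard ?_ ((finite_setOf_isIrrChar G).subset fun _ h => h.1.1)
      rintro _ ⟨φ, hφ, rfl⟩
      refine ⟨hθ φ, lin φ, hlift _ (hlin_irr φ) (hlin_ker φ), fun h1 => hφ (hlin_inj ?_), ?_⟩
      · rw [h1]
        funext m
        simp [lin]
      · obtain ⟨_, _, _, _, _, _, hnorm⟩ := (hlin_irr φ).exists_representation
        have hscal : charInner M (lin φ) (resChar M (θ φ)) =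
            (starRingEnd ℂ) (θ φ 1) * charInner M (lin φ) (lin φ) := by
          cases nonempty_fintype M
          simp only [charInner, hres, finsum_eq_sum_of_fintype, map_mul, Finset.mul_sum]
          exact Finset.sum_congr rfl fun m _ => by ring
        rw [hscal, hnorm, mul_one]
        exact (map_ne_zero _).mpr (hθ φ).1.apply_one_ne_zero
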